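/- Let M=(Q,Σ,μ,F) be a dwta over the commutative semifield S whose states are all live, let sol assign to every ∼_M-class B a context sol(B)∈C_Σ(Q) that is a sign of life for every state in B with sol(B)=□ whenever B⊆F, let λ(q) = h_μ^{(2)}(sol([q]_{∼_M})[q]) for every q∈Q, and let N = syn(push_λ(M)). Then the Myhill–Nerode equivalence of M equals the weak equivalence of N: ≡_M = ∼_N. -/

import Mathlib

open scoped BigOperators Classical

namespace WTA

/-- Trees over a ranked alphabet `Sig` (with arity map `ar`), indexed by states `Q`. -/
inductive PTree (Sig : Type) (ar : Sig → ℕ) (Q : Type) : Type where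
  | state : Q → PTree Sig ar Q
  | node : (s : Sig) → (Fin (ar s) → PTree Sig ar Q) → PTree Sig ar Q

/-- Contexts: trees with exactly one occurrence of the hole `□` at a leaf. -/
inductive Ctx (Sig : Type) (ar : Sig → ℕ) (Q : Type) : Type where
  | hole : Ctx Sig ar Q
  | node : (s : Sig) → (i : Fin (ar s)) → (Fin (ar s) → PTree Sig ar Q) →
      Ctx Sig ar Q → Ctx Sig ar Q

variable {Sig Q Q' S : Type} {ar : Sig → ℕ}

/-- Substitution `c[t]` of a tree into the hole of a context. -/
def Ctx.subst : Ctx Sig ar Q → PTree Sig ar Q → PTree Sig ar Q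
  | .hole, t => t
  | .node s i ts c, t => .node s (Function.update ts i (c.subst t))

/-- A closed tree (over `T_Σ`) viewed as a tree indexed by `Q`. -/
def PTree.ofClosed : PTree Sig ar Empty → PTree Sig ar Q
  | .state e => e.elim
  | .node s ts => .node s fun i => (ts i).ofClosed

/-- A closed context viewed as a context with states in `Q`. -/
def Ctx.ofClosed : Ctx Sig ar Empty → Ctx Sig ar Q
  | .hole => .hole
  | .node s i ts c => .node s i (fun j => (ts j).ofClosed) c.ofClosed

/-- Renaming of the states occurring in a tree. -/
def PTree.rename (g : Q → Q') : PTree Sig ar Q → PTree Sig ar Q'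
  | .state p => .state (g p)
  | .node s ts => .node s fun i => (ts i).rename g

/-- Renaming of the states occurring in a context. -/
def Ctx.rename (g : Q → Q') : Ctx Sig ar Q → Ctx Sig ar Q'
  | .hole => .hole
  | .node s i ts c => .node s i (fun j => (ts j).rename g) (c.rename g)

/-- The extension `h_μ` of the transition weight assignment `μ` to trees:
`h_μ(t → q)`. -/
noncomputable def hmu [Fintype Q] [CommSemiring S]
    (μ : ∀ s : Sig, (Fin (ar s) → Q) → Q → S) : PTree Sig ar Q → Q → S
  | .state p, q => if p = q then 1 else 0
  | .node s ts, q => ∑ qs : Fin (ar s) → Q, μ s qs q * ∏ i, hmu μ (ts i) (qs i)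

/-- The weighted tree language recognized by the wta `(Q, Σ, μ, F)`:
`M(t) = Σ_{q ∈ F} h_μ(t → q)`. -/
noncomputable def wtaSem [Fintype Q] [CommSemiring S]
    (μ : ∀ s : Sig, (Fin (ar s) → Q) → Q → S) (F : Finset Q)
    (t : PTree Sig ar Empty) : S :=
  ∑ q ∈ F, hmu μ (PTree.ofClosed t) q

/-- Bottom-up determinism: every left-hand side `σ(q₁,…,q_k)` has at most one
target state with nonzero weight. -/
def Deterministic [CommSemiring S] (μ : ∀ s : Sig, (Fin (ar s) → Q) → Q → S) : Prop :=
  ∀ (s : Sig) (qs : Fin (ar s) → Q) (q q' : Q), μ s qs q ≠ 0 → μ s qs q' ≠ 0 → q = q'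

/-- The pushed transition weight assignment
`μ'(σ(q₁,…,q_k) → q) = λ(q) · μ(σ(q₁,…,q_k) → q) · ∏ᵢ λ(qᵢ)⁻¹`. -/
noncomputable def push [Fintype Q] [Semifield S] (lam : Q → S)
    (μ : ∀ s : Sig, (Fin (ar s) → Q) → Q → S) :
    ∀ s : Sig, (Fin (ar s) → Q) → Q → S :=
  fun s qs q => lam q * μ s qs q * ∏ i, (lam (qs i))⁻¹

/-- `h_μ^{(1)}(t) ∈ F` (for a deterministic wta): some final state is reached
with nonzero weight. -/
def finReach [Fintype Q] [CommSemiring S]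
    (μ : ∀ s : Sig, (Fin (ar s) → Q) → Q → S) (F : Finset Q)
    (t : PTree Sig ar Q) : Prop :=
  ∃ q ∈ F, hmu μ t q ≠ 0

/-- `h_μ^{(2)}(t) · χ_F(h_μ^{(1)}(t))` (for a deterministic wta); an undefined
value counts as `0`. -/
noncomputable def cweight [Fintype Q] [CommSemiring S]
    (μ : ∀ s : Sig, (Fin (ar s) → Q) → Q → S) (F : Finset Q)
    (t : PTree Sig ar Q) : S :=
  ∑ q ∈ F, hmu μ t q

/-- `h_μ^{(2)}(t)` (for a deterministic wta); an undefined value counts as `0`. -/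
noncomputable def tweight [Fintype Q] [CommSemiring S]
    (μ : ∀ s : Sig, (Fin (ar s) → Q) → Q → S) (t : PTree Sig ar Q) : S :=
  ∑ q, hmu μ t q

/-- A context `c` is a sign of life for the state `q` if `h_μ^{(1)}(c[q]) ∈ F`. -/
def SignOfLife [Fintype Q] [CommSemiring S]
    (μ : ∀ s : Sig, (Fin (ar s) → Q) → Q → S) (F : Finset Q)
    (c : Ctx Sig ar Q) (q : Q) : Prop :=
  finReach μ F (c.subst (.state q))

/-- A state is live if it has a sign of life. -/
def Live [Fintype Q] [CommSemiring S]
    (μ : ∀ s : Sig, (Fin (ar s) → Q) → Q → S) (F : Finset Q) (q : Q) : Prop :=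
  ∃ c : Ctx Sig ar Q, SignOfLife μ F c q

/-- Weak equivalence `q₁ ∼_M q₂`. -/
def WeakEquiv [Fintype Q] [CommSemiring S]
    (μ : ∀ s : Sig, (Fin (ar s) → Q) → Q → S) (F : Finset Q)
    (q₁ q₂ : Q) : Prop :=
  ∀ c : Ctx Sig ar Q,
    finReach μ F (c.subst (.state q₁)) ↔ finReach μ F (c.subst (.state q₂))

/-- Myhill–Nerode equivalence `q₁ ≡_M q₂`: there is a nonzero factor `s` with
`h_μ^{(2)}(c[q₁])·χ_F(h_μ^{(1)}(c[q₁])) = s · h_μ^{(2)}(c[q₂])·χ_F(h_μ^{(1)}(c[q₂]))`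
for all contexts `c`. -/
def MNEquiv [Fintype Q] [CommSemiring S]
    (μ : ∀ s : Sig, (Fin (ar s) → Q) → Q → S) (F : Finset Q)
    (q₁ q₂ : Q) : Prop :=
  ∃ s : S, s ≠ 0 ∧ ∀ c : Ctx Sig ar Q,
    cweight μ F (c.subst (.state q₁)) = s * cweight μ F (c.subst (.state q₂))

/-- `r` is a congruence of the dwta: equivalent left-hand sides have equivalent
targets (`μ^{(1)}`-values), where two undefined values are regarded as
equivalent and an undefined value is never equivalent to a defined one. -/
def IsCongruence [Fintype Q] [CommSemiring S]
    (μ : ∀ s : Sig, (Fin (ar s) → Q) → Q → S) (r : Q → Q → Prop) : Prop :=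
  ∀ (s : Sig) (qs qs' : Fin (ar s) → Q), (∀ i, r (qs i) (qs' i)) →
    ((∃ q, μ s qs q ≠ 0) ↔ (∃ q, μ s qs' q ≠ 0)) ∧
    (∀ q q', μ s qs q ≠ 0 → μ s qs' q' ≠ 0 → r q q')

/-- `r` respects `F`: every class lies inside `F` or outside `F`. -/
def Respects (r : Q → Q → Prop) (F : Finset Q) : Prop :=
  ∀ q q', r q q' → (q ∈ F ↔ q' ∈ F)

/-- Accessibility: every state is reached by some (closed) tree. -/
def Accessible [Fintype Q] [CommSemiring S]
    (μ : ∀ s : Sig, (Fin (ar s) → Q) → Q → S) : Prop :=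
  ∀ q : Q, ∃ t : PTree Sig ar Empty, hmu μ (PTree.ofClosed t) q ≠ 0

/-- The transition weight assignment of the alphabetic dwta `syn(N)` over the
ranked alphabet `Σ × S` (where `⟨σ, s⟩` has the rank of `σ`):
`ν''(⟨σ,s⟩(q₁,…,q_k) → q) = 1` iff `ν(σ(q₁,…,q_k) → q) = s ≠ 0`. -/
noncomputable def synMu [Fintype Q] [CommSemiring S]
    (ν : ∀ s : Sig, (Fin (ar s) → Q) → Q → S) :
    ∀ p : Sig × S, (Fin ((fun p : Sig × S => ar p.1) p) → Q) → Q → S :=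
  fun p qs q => if ν p.1 qs q = p.2 ∧ p.2 ≠ 0 then 1 else 0

/-- Runs of the unweighted tree automaton `unw(M)` with transitions `supp(μ)`:
`Reach μ t q` iff `unw(M)` can reach state `q` on the tree `t`. -/
inductive Reach [CommSemiring S] (μ : ∀ s : Sig, (Fin (ar s) → Q) → Q → S) :
    PTree Sig ar Q → Q → Prop where
  | state (q : Q) : Reach μ (.state q) q
  | node {s : Sig} (ts : Fin (ar s) → PTree Sig ar Q) (qs : Fin (ar s) → Q) (q : Q)
      (h : μ s qs q ≠ 0) (hc : ∀ i, Reach μ (ts i) (qs i)) : Reach μ (.node s ts) q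

section Contexts

variable {Sig Q : Type} {ar : Sig → ℕ}

/-- Composition `d[c]` of contexts. -/
def Ctx.comp : Ctx Sig ar Q → Ctx Sig ar Q → Ctx Sig ar Q
  | .hole, c => c
  | .node s i ts d, c => .node s i ts (d.comp c)

theorem Ctx.subst_comp (d c : Ctx Sig ar Q) (t : PTree Sig ar Q) :
    (d.comp c).subst t = d.subst (c.subst t) := by
  induction d with
  | hole => rfl
  | node s i ts d ih => simp only [Ctx.comp, Ctx.subst, ih]

/-- The one-letter context with symbol `s`, hole at position `i` and states elsewhere. -/
def Ctx.letter (s : Sig) (i : Fin (ar s)) (qs : Fin (ar s) → Q) : Ctx Sig ar Q :=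
  .node s i (fun j => .state (qs j)) .hole

theorem Ctx.letter_subst_state (s : Sig) (i : Fin (ar s)) (qs : Fin (ar s) → Q) (p : Q) :
    (Ctx.letter s i qs).subst (.state p) =
      (.node s fun j => .state (Function.update qs i p j) : PTree Sig ar Q) := by
  simp only [Ctx.letter, Ctx.subst]
  congr 1
  funext j
  by_cases h : j = i
  · subst h; simp
  · simp [h]

end Contexts

section Linearity

variable {Sig Q S : Type} {ar : Sig → ℕ} [Fintype Q] [CommSemiring S]

theorem hmu_update (μ : ∀ s : Sig, (Fin (ar s) → Q) → Q → S) (s : Sig) (i : Fin (ar s))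
    (ts : Fin (ar s) → PTree Sig ar Q) (t : PTree Sig ar Q) (q : Q) :
    hmu μ (.node s (Function.update ts i t)) q = ∑ qs : Fin (ar s) → Q,
      μ s qs q * (hmu μ t (qs i) * ∏ j ∈ Finset.univ.erase i, hmu μ (ts j) (qs j)) := by
  simp only [hmu]
  refine Finset.sum_congr rfl fun qs _ => ?_
  rw [← Finset.mul_prod_erase _ _ (Finset.mem_univ i), Function.update_self]
  congr 2
  refine Finset.prod_congr rfl fun j hj => ?_
  rw [Function.update_of_ne (Finset.ne_of_mem_erase hj)]

theorem hmu_subst (μ : ∀ s : Sig, (Fin (ar s) → Q) → Q → S) (c : Ctx Sig ar Q)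
    (t : PTree Sig ar Q) (q : Q) :
    hmu μ (c.subst t) q = ∑ p, hmu μ t p * hmu μ (c.subst (.state p)) q := by
  induction c generalizing q with
  | hole => simp [Ctx.subst, hmu]
  | node s i ts c ih =>
    simp only [Ctx.subst, hmu_update]
    simp_rw [Finset.mul_sum]
    rw [Finset.sum_comm]
    refine Finset.sum_congr rfl fun qs _ => ?_
    rw [ih, Finset.sum_mul, Finset.mul_sum]
    refine Finset.sum_congr rfl fun p _ => ?_
    ring

theorem cweight_subst (μ : ∀ s : Sig, (Fin (ar s) → Q) → Q → S) (F : Finset Q)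
    (c : Ctx Sig ar Q) (t : PTree Sig ar Q) :
    cweight μ F (c.subst t) = ∑ p, hmu μ t p * cweight μ F (c.subst (.state p)) := by
  simp only [cweight, Finset.mul_sum]
  rw [Finset.sum_comm]
  exact Finset.sum_congr rfl fun q _ => hmu_subst μ c t q

theorem hmu_node_state (μ : ∀ s : Sig, (Fin (ar s) → Q) → Q → S) (s : Sig)
    (qs : Fin (ar s) → Q) (q : Q) :
    hmu μ (.node s fun j => .state (qs j)) q = μ s qs q := by
  simp only [hmu]
  rw [Finset.sum_eq_single qs]
  · simp
  · intro r _ hr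
    obtain ⟨j, hj⟩ := Function.ne_iff.mp hr
    rw [Finset.prod_eq_zero (Finset.mem_univ j), mul_zero]
    simp [hj.symm]
  · simp

theorem hmu_letter (μ : ∀ s : Sig, (Fin (ar s) → Q) → Q → S) (s : Sig) (i : Fin (ar s))
    (qs : Fin (ar s) → Q) (p q : Q) :
    hmu μ ((Ctx.letter s i qs).subst (.state p)) q = μ s (Function.update qs i p) q := by
  rw [Ctx.letter_subst_state, hmu_node_state]

theorem exists_of_hmu_node_ne_zero {μ : ∀ s : Sig, (Fin (ar s) → Q) → Q → S} {s : Sig}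
    {ts : Fin (ar s) → PTree Sig ar Q} {q : Q} (h : hmu μ (.node s ts) q ≠ 0) :
    ∃ qs, μ s qs q ≠ 0 ∧ ∀ j, hmu μ (ts j) (qs j) ≠ 0 := by
  rw [hmu] at h
  obtain ⟨qs, -, hqs⟩ := Finset.exists_ne_zero_of_sum_ne_zero h
  refine ⟨qs, left_ne_zero_of_mul hqs, fun j hj => hqs ?_⟩
  rw [Finset.prod_eq_zero (Finset.mem_univ j) hj, mul_zero]

end Linearity

section Determinism

variable {Sig Q S : Type} {ar : Sig → ℕ} [Fintype Q] [CommSemiring S]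
  {μ : ∀ s : Sig, (Fin (ar s) → Q) → Q → S}

theorem Deterministic.hmu_unique (hdet : Deterministic μ) (t : PTree Sig ar Q) {q q' : Q}
    (h : hmu μ t q ≠ 0) (h' : hmu μ t q' ≠ 0) : q = q' := by
  induction t generalizing q q' with
  | state p =>
    simp only [hmu, ne_eq, ite_eq_right_iff, not_forall] at h h'
    exact h.1.symm.trans h'.1
  | node s ts ih =>
    obtain ⟨qs, hq, hqs⟩ := exists_of_hmu_node_ne_zero h
    obtain ⟨qs', hq', hqs'⟩ := exists_of_hmu_node_ne_zero h'
    obtain rfl : qs = qs' := funext fun j => ih j (hqs j) (hqs' j)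
    exact hdet s qs q q' hq hq'

theorem Deterministic.hmu_eq_zero (hdet : Deterministic μ) {t : PTree Sig ar Q} {q q' : Q}
    (h : hmu μ t q ≠ 0) (hne : q' ≠ q) : hmu μ t q' = 0 :=
  by_contra fun h' => hne (hdet.hmu_unique t h' h)

theorem Deterministic.hmu_node (hdet : Deterministic μ) {s : Sig}
    {ts : Fin (ar s) → PTree Sig ar Q} {qs : Fin (ar s) → Q}
    (h : ∀ j, hmu μ (ts j) (qs j) ≠ 0) (q : Q) :
    hmu μ (.node s ts) q = μ s qs q * ∏ j, hmu μ (ts j) (qs j) := by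
  rw [hmu, Finset.sum_eq_single qs]
  · intro r _ hr
    obtain ⟨j, hj⟩ := Function.ne_iff.mp hr
    rw [Finset.prod_eq_zero (Finset.mem_univ j) (hdet.hmu_eq_zero (h j) hj), mul_zero]
  · simp

theorem Deterministic.cweight_eq (hdet : Deterministic μ) {F : Finset Q}
    {t : PTree Sig ar Q} {q : Q} (hq : q ∈ F) (h : hmu μ t q ≠ 0) :
    cweight μ F t = hmu μ t q :=
  Finset.sum_eq_single_of_mem q hq fun _ _ hne => hdet.hmu_eq_zero h hne

theorem Deterministic.tweight_eq (hdet : Deterministic μ)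
    {t : PTree Sig ar Q} {q : Q} (h : hmu μ t q ≠ 0) : tweight μ t = hmu μ t q :=
  Finset.sum_eq_single_of_mem q (Finset.mem_univ q) fun _ _ hne => hdet.hmu_eq_zero h hne

theorem Deterministic.finReach_iff (hdet : Deterministic μ) (F : Finset Q)
    (t : PTree Sig ar Q) : finReach μ F t ↔ cweight μ F t ≠ 0 := by
  constructor
  · rintro ⟨q, hq, h⟩
    rwa [hdet.cweight_eq hq h]
  · exact Finset.exists_ne_zero_of_sum_ne_zero

theorem Deterministic.tweight_eq_cweight (hdet : Deterministic μ) {F : Finset Q}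
    {t : PTree Sig ar Q} (h : finReach μ F t) : tweight μ t = cweight μ F t := by
  obtain ⟨q, hq, h⟩ := h
  rw [hdet.cweight_eq hq h, hdet.tweight_eq h]

theorem Deterministic.cweight_subst_eq (hdet : Deterministic μ) (F : Finset Q)
    (c : Ctx Sig ar Q) {t : PTree Sig ar Q} {p : Q} (h : hmu μ t p ≠ 0) :
    cweight μ F (c.subst t) = hmu μ t p * cweight μ F (c.subst (.state p)) := by
  rw [cweight_subst]
  refine Finset.sum_eq_single_of_mem p (Finset.mem_univ p) fun r _ hr => ?_
  rw [hdet.hmu_eq_zero h hr, zero_mul]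

theorem exists_of_cweight_subst_ne_zero {F : Finset Q} {c : Ctx Sig ar Q}
    {t : PTree Sig ar Q} (h : cweight μ F (c.subst t) ≠ 0) : ∃ p, hmu μ t p ≠ 0 := by
  rw [cweight_subst] at h
  obtain ⟨p, -, hp⟩ := Finset.exists_ne_zero_of_sum_ne_zero h
  exact ⟨p, left_ne_zero_of_mul hp⟩

theorem finReach_state [Nontrivial S] {F : Finset Q} {q : Q} :
    finReach μ F (.state q) ↔ q ∈ F := by
  simp [finReach, hmu]

theorem MNEquiv.weakEquiv [NoZeroDivisors S] (hdet : Deterministic μ) {F : Finset Q} {q q' : Q}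
    (h : MNEquiv μ F q q') : WeakEquiv μ F q q' := by
  obtain ⟨s, hs, h⟩ := h
  intro c
  rw [hdet.finReach_iff, hdet.finReach_iff, h c]
  simp [hs]

end Determinism

section WeightedSimulation

variable {Sig Q S : Type} {ar : Sig → ℕ} [Fintype Q] [CommSemiring S]
  {μ : ∀ s : Sig, (Fin (ar s) → Q) → Q → S}

/-- `r` is a simulation that preserves the weights of transitions exactly. -/
def IsSimulation (μ : ∀ s : Sig, (Fin (ar s) → Q) → Q → S) (r : Q → Q → Prop) : Prop :=
  ∀ p p', r p p' → ∀ (s : Sig) (i : Fin (ar s)) (qs : Fin (ar s) → Q) (u : Q),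
    μ s (Function.update qs i p) u ≠ 0 →
      ∃ u', μ s (Function.update qs i p') u' = μ s (Function.update qs i p) u ∧ r u u'

theorem IsSimulation.hmu_subst {r : Q → Q → Prop} (hr : IsSimulation μ r)
    (hdet : Deterministic μ) (c : Ctx Sig ar Q) {p p' : Q} (hp : r p p') {u : Q}
    (hu : hmu μ (c.subst (.state p)) u ≠ 0) :
    ∃ u', hmu μ (c.subst (.state p')) u' = hmu μ (c.subst (.state p)) u ∧ r u u' := by
  induction c generalizing u with
  | hole =>
    simp only [Ctx.subst, hmu, ne_eq, ite_eq_right_iff, not_forall] at hu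
    obtain ⟨rfl, -⟩ := hu
    exact ⟨p', by simp [Ctx.subst, hmu], hp⟩
  | node s i ts c ih =>
    simp only [Ctx.subst] at hu ⊢
    obtain ⟨qs, hq, hqs⟩ := exists_of_hmu_node_ne_zero hu
    obtain ⟨v, hv, hrv⟩ := ih (u := qs i) (by simpa using hqs i)
    obtain ⟨u', hu', hru⟩ := hr _ _ hrv s i qs u (by simpa using hq)
    rw [Function.update_eq_self] at hu'
    have hprod : ∀ j, hmu μ (Function.update ts i (c.subst (.state p')) j)
        (Function.update qs i v j) =
        hmu μ (Function.update ts i (c.subst (.state p)) j) (qs j) := by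
      intro j
      by_cases h : j = i
      · subst h; simpa using hv
      · simp [h]
    refine ⟨u', ?_, hru⟩
    rw [hdet.hmu_node hqs, hdet.hmu_node (qs := Function.update qs i v), hu']
    · simp only [hprod]
    · intro j
      rw [hprod]
      exact hqs j

theorem IsSimulation.cweight_subst {r : Q → Q → Prop} (hr : IsSimulation μ r)
    (hsymm : ∀ p p', r p p' → r p' p) (hdet : Deterministic μ) {F : Finset Q}
    (hF : Respects r F) (c : Ctx Sig ar Q) {p p' : Q} (hp : r p p') :
    cweight μ F (c.subst (.state p)) = cweight μ F (c.subst (.state p')) := by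
  have key : ∀ p p', r p p' → cweight μ F (c.subst (.state p)) ≠ 0 →
      cweight μ F (c.subst (.state p)) = cweight μ F (c.subst (.state p')) := by
    intro p p' hp h
    obtain ⟨u, huF, hu⟩ := (hdet.finReach_iff F _).mpr h
    obtain ⟨u', hu', hru⟩ := hr.hmu_subst hdet c hp hu
    rw [hdet.cweight_eq huF hu, ← hu',
      hdet.cweight_eq ((hF _ _ hru).mp huF) (hu' ▸ hu)]
  by_cases h : cweight μ F (c.subst (.state p)) = 0
  · by_contra hne
    exact hne (key p' p (hsymm _ _ hp) fun h' => hne (h.trans h'.symm)).symm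
  · exact key p p' hp h

end WeightedSimulation

section LeafWeight

variable {Sig Q S : Type} {ar : Sig → ℕ} [Semifield S]

/-- The product of the weights `lam` of the leaves of a tree labelled by states. -/
noncomputable def PTree.leafWeight (lam : Q → S) : PTree Sig ar Q → S
  | .state p => lam p
  | .node _ ts => ∏ i, (ts i).leafWeight lam

theorem PTree.leafWeight_ne_zero {lam : Q → S} (hlam : ∀ q, lam q ≠ 0) (t : PTree Sig ar Q) :
    t.leafWeight lam ≠ 0 := by
  induction t with
  | state p => exact hlam p
  | node s ts ih => exact Finset.prod_ne_zero_iff.mpr fun i _ => ih i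

theorem Ctx.exists_leafWeight_subst {lam : Q → S} (hlam : ∀ q, lam q ≠ 0) (c : Ctx Sig ar Q) :
    ∃ k : S, k ≠ 0 ∧ ∀ q, (c.subst (.state q)).leafWeight lam = lam q * k := by
  induction c with
  | hole => exact ⟨1, one_ne_zero, fun q => by simp [Ctx.subst, PTree.leafWeight]⟩
  | node s i ts c ih =>
    obtain ⟨k, hk, h⟩ := ih
    refine ⟨k * ∏ j ∈ Finset.univ.erase i, (ts j).leafWeight lam, mul_ne_zero hk
      (Finset.prod_ne_zero_iff.mpr fun j _ => (ts j).leafWeight_ne_zero hlam), fun q => ?_⟩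
    simp only [Ctx.subst, PTree.leafWeight]
    rw [← Finset.mul_prod_erase _ _ (Finset.mem_univ i), Function.update_self, h, mul_assoc]
    congr 2
    refine Finset.prod_congr rfl fun j hj => ?_
    rw [Function.update_of_ne (Finset.ne_of_mem_erase hj)]

end LeafWeight

section Pushing

variable {Sig Q S : Type} {ar : Sig → ℕ} [Fintype Q] [Semifield S]
  {μ : ∀ s : Sig, (Fin (ar s) → Q) → Q → S}

theorem Deterministic.push (hdet : Deterministic μ) (lam : Q → S) :
    Deterministic (push lam μ) := by
  intro s qs q q' h h'
  exact hdet s qs q q' (right_ne_zero_of_mul (left_ne_zero_of_mul h))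
    (right_ne_zero_of_mul (left_ne_zero_of_mul h'))

theorem hmu_push {lam : Q → S} (hlam : ∀ q, lam q ≠ 0) (t : PTree Sig ar Q) (q : Q) :
    hmu (push lam μ) t q * t.leafWeight lam = lam q * hmu μ t q := by
  induction t generalizing q with
  | state p =>
    by_cases h : p = q
    · subst h; simp [hmu, PTree.leafWeight]
    · simp [hmu, h]
  | node s ts ih =>
    simp only [hmu, PTree.leafWeight, Finset.sum_mul, Finset.mul_sum]
    refine Finset.sum_congr rfl fun qs _ => ?_
    rw [mul_assoc, ← Finset.prod_mul_distrib, Finset.prod_congr rfl fun i _ => ih i (qs i),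
      push, mul_assoc, ← Finset.prod_mul_distrib,
      Finset.prod_congr rfl fun i _ => inv_mul_cancel_left₀ (hlam (qs i)) _, mul_assoc]

theorem cweight_push {lam : Q → S} (hlam : ∀ q, lam q ≠ 0) {F : Finset Q}
    (hF : ∀ q ∈ F, lam q = 1) (t : PTree Sig ar Q) :
    cweight (push lam μ) F t * t.leafWeight lam = cweight μ F t := by
  simp only [cweight, Finset.sum_mul]
  refine Finset.sum_congr rfl fun q hq => ?_
  rw [hmu_push hlam, hF q hq, one_mul]

theorem Live.push (hdet : Deterministic μ) {lam : Q → S} (hlam : ∀ q, lam q ≠ 0)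
    {F : Finset Q} (hF : ∀ q ∈ F, lam q = 1) {q : Q} (h : Live μ F q) :
    Live (push lam μ) F q := by
  obtain ⟨c, hc⟩ := h
  refine ⟨c, ((hdet.push lam).finReach_iff _ _).mpr fun h0 => (hdet.finReach_iff _ _).mp hc ?_⟩
  rw [← cweight_push hlam hF, h0, zero_mul]

/-- Equality of all context weights in the pushed automaton yields Myhill–Nerode equivalence. -/
theorem mnEquiv_of_cweight_push_eq {lam : Q → S} (hlam : ∀ q, lam q ≠ 0) {F : Finset Q}
    (hF : ∀ q ∈ F, lam q = 1) {q q' : Q}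
    (h : ∀ c : Ctx Sig ar Q, cweight (push lam μ) F (c.subst (.state q)) =
      cweight (push lam μ) F (c.subst (.state q'))) : MNEquiv μ F q q' := by
  refine ⟨lam q * (lam q')⁻¹, mul_ne_zero (hlam q) (inv_ne_zero (hlam q')), fun c => ?_⟩
  obtain ⟨k, -, hk⟩ := c.exists_leafWeight_subst hlam
  rw [← cweight_push hlam hF (c.subst (.state q)), ← cweight_push hlam hF (c.subst (.state q')),
    hk, hk, h]
  have := hlam q'
  field_simp

theorem push_update (lam : Q → S) (s : Sig) (i : Fin (ar s)) (qs : Fin (ar s) → Q) (p u : Q) :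
    push lam μ s (Function.update qs i p) u =
      lam u * μ s (Function.update qs i p) u *
        ((lam p)⁻¹ * ∏ j ∈ Finset.univ.erase i, (lam (qs j))⁻¹) := by
  rw [push, ← Finset.mul_prod_erase _ _ (Finset.mem_univ i), Function.update_self]
  congr 2
  refine Finset.prod_congr rfl fun j hj => ?_
  rw [Function.update_of_ne (Finset.ne_of_mem_erase hj)]

theorem isSimulation_mnEquiv_push (hdet : Deterministic μ) {F : Finset Q}
    (hlive : ∀ q, Live μ F q) {lam : Q → S} (hlam : ∀ q, lam q ≠ 0)
    (hscale : ∀ (s : S) (p p' : Q), s ≠ 0 → (∀ c : Ctx Sig ar Q,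
      cweight μ F (c.subst (.state p)) = s * cweight μ F (c.subst (.state p'))) →
      lam p = s * lam p') :
    IsSimulation (push lam μ) (MNEquiv μ F) := by
  rintro p p' ⟨k, hk, hpp⟩ s i qs u hu
  have ha : μ s (Function.update qs i p) u ≠ 0 :=
    right_ne_zero_of_mul (left_ne_zero_of_mul hu)
  have hcw : ∀ (q v : Q), μ s (Function.update qs i q) v ≠ 0 → ∀ d : Ctx Sig ar Q,
      cweight μ F ((d.comp (.letter s i qs)).subst (.state q)) =
        μ s (Function.update qs i q) v * cweight μ F (d.subst (.state v)) := by
    intro q v hv d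
    rw [← hmu_letter μ s i qs q v] at hv ⊢
    rw [Ctx.subst_comp, hdet.cweight_subst_eq F d hv]
  obtain ⟨d, hd⟩ := hlive u
  have h0 := mul_ne_zero ha ((hdet.finReach_iff _ _).mp hd)
  rw [← hcw p u ha, hpp, Ctx.subst_comp] at h0
  obtain ⟨u', hu'⟩ := exists_of_cweight_subst_ne_zero (right_ne_zero_of_mul h0)
  rw [hmu_letter] at hu'
  set a := μ s (Function.update qs i p) u with ha_def
  set a' := μ s (Function.update qs i p') u' with ha'_def
  have hs : k * a' * a⁻¹ ≠ 0 := mul_ne_zero (mul_ne_zero hk hu') (inv_ne_zero ha)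
  have huu : ∀ c : Ctx Sig ar Q, cweight μ F (c.subst (.state u)) =
      k * a' * a⁻¹ * cweight μ F (c.subst (.state u')) := by
    intro c
    have h := hpp (c.comp (.letter s i qs))
    rw [hcw p u ha, hcw p' u' hu', ← ha_def, ← ha'_def] at h
    rw [← inv_mul_cancel_left₀ ha (cweight μ F (c.subst (.state u))), h]
    ring
  refine ⟨u', ?_, _, hs, huu⟩
  rw [push_update, push_update, ← ha_def, ← ha'_def, hscale _ _ _ hs huu,
    hscale k p p' hk hpp]
  have := hlam p'
  field_simp

end Pushing

section Synthesis

variable {Sig Q S : Type} {ar : Sig → ℕ} [Fintype Q] [CommSemiring S]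
  {ν : ∀ s : Sig, (Fin (ar s) → Q) → Q → S}

theorem eq_of_synMu_ne_zero {p : Sig × S} {qs : Fin (ar p.1) → Q} {q : Q}
    (h : synMu ν p qs q ≠ 0) : ν p.1 qs q = p.2 ∧ p.2 ≠ 0 := by
  by_contra h'
  exact h (if_neg h')

theorem synMu_apply_self {s : Sig} {qs : Fin (ar s) → Q} {q : Q} (h : ν s qs q ≠ 0) :
    synMu ν (s, ν s qs q) qs q = 1 :=
  if_pos ⟨rfl, h⟩

theorem Deterministic.synMu (hdet : Deterministic ν) :
    Deterministic (ar := fun p : Sig × S => ar p.1) (synMu ν) := by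
  intro p qs q q' h h'
  obtain ⟨h1, h2⟩ := eq_of_synMu_ne_zero h
  obtain ⟨h1', -⟩ := eq_of_synMu_ne_zero h'
  exact hdet p.1 qs q q' (h1 ▸ h2) (h1' ▸ h2)

theorem IsSimulation.synMu {r : Q → Q → Prop} (hr : IsSimulation ν r) :
    IsSimulation (ar := fun p : Sig × S => ar p.1) (synMu ν) r := by
  intro p p' hp s i qs u hu
  obtain ⟨h1, h2⟩ := eq_of_synMu_ne_zero hu
  obtain ⟨u', hu', hru⟩ := hr p p' hp s.1 i qs u (h1 ▸ h2)
  exact ⟨u', by simp only [WTA.synMu, hu'], hru⟩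

theorem exists_hmu_synMu_subst_ne_zero [Nontrivial S] (hdet : Deterministic ν)
    (c : Ctx Sig ar Q) {p u : Q} (hu : hmu ν (c.subst (.state p)) u ≠ 0) :
    ∃ d : Ctx (Sig × S) (fun p : Sig × S => ar p.1) Q,
      hmu (synMu ν) (d.subst (.state p)) u ≠ 0 := by
  induction c generalizing u with
  | hole =>
    refine ⟨.hole, ?_⟩
    simp only [Ctx.subst, hmu, ne_eq, ite_eq_right_iff, not_forall] at hu ⊢
    exact ⟨hu.1, one_ne_zero⟩
  | node s i ts c ih =>
    obtain ⟨qs, hq, hqs⟩ := exists_of_hmu_node_ne_zero hu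
    obtain ⟨d, hd⟩ := ih (u := qs i) (by simpa using hqs i)
    refine ⟨(Ctx.letter (ar := fun p : Sig × S => ar p.1) (s, ν s qs u) i qs).comp d, ?_⟩
    rw [Ctx.subst_comp, hmu_subst, Finset.sum_eq_single_of_mem (qs i) (Finset.mem_univ _),
      hmu_letter, Function.update_eq_self, synMu_apply_self hq, mul_one]
    · exact hd
    · intro v _ hv
      rw [hdet.synMu.hmu_eq_zero hd hv, zero_mul]

theorem Live.synMu [Nontrivial S] (hdet : Deterministic ν) {F : Finset Q} {q : Q}
    (h : Live ν F q) : Live (ar := fun p : Sig × S => ar p.1) (synMu ν) F q := by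
  obtain ⟨c, u, huF, hu⟩ := h
  obtain ⟨d, hd⟩ := exists_hmu_synMu_subst_ne_zero hdet c hu
  exact ⟨d, u, huF, hd⟩

theorem isSimulation_weakEquiv_synMu [Nontrivial S] (hdet : Deterministic ν) {F : Finset Q}
    (hlive : ∀ q, Live (ar := fun p : Sig × S => ar p.1) (synMu ν) F q) :
    IsSimulation ν (WeakEquiv (ar := fun p : Sig × S => ar p.1) (synMu ν) F) := by
  intro p p' hpp s i qs u hu
  set a := ν s (Function.update qs i p) u with ha
  let l : Ctx (Sig × S) (fun p : Sig × S => ar p.1) Q :=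
    Ctx.letter (ar := fun p : Sig × S => ar p.1) (s, a) i qs
  have hone : ∀ q v, ν s (Function.update qs i q) v = a →
      hmu (synMu ν) (l.subst (.state q)) v = 1 := by
    intro q v h
    rw [hmu_letter]
    exact if_pos ⟨h, hu⟩
  have hcw : ∀ q v, ν s (Function.update qs i q) v = a →
      ∀ d : Ctx (Sig × S) (fun p : Sig × S => ar p.1) Q,
      (finReach (synMu ν) F ((d.comp l).subst (.state q)) ↔
        finReach (synMu ν) F (d.subst (.state v))) := by
    intro q v h d
    have h1 := hone q v h
    rw [hdet.synMu.finReach_iff, hdet.synMu.finReach_iff, Ctx.subst_comp,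
      hdet.synMu.cweight_subst_eq F d (h1 ▸ one_ne_zero), h1, one_mul]
  obtain ⟨d, hd⟩ := hlive u
  have h0 := (hpp _).mp ((hcw p u rfl d).mpr hd)
  rw [hdet.synMu.finReach_iff, Ctx.subst_comp] at h0
  obtain ⟨u', hu'⟩ := exists_of_cweight_subst_ne_zero h0
  rw [hmu_letter] at hu'
  have hau : ν s (Function.update qs i p') u' = a := (eq_of_synMu_ne_zero hu').1
  exact ⟨u', hau, fun e => (hcw p u rfl e).symm.trans ((hpp _).trans (hcw p' u' hau e))⟩

end Synthesis

/-- With pushing weights `λ(q) = h_μ^{(2)}(sol([q]_{∼_M})[q])`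
and `N = syn(push_λ(M))`, the Myhill–Nerode equivalence of `M` equals the weak
equivalence of `N`: `≡_M = ∼_N`. -/
theorem mnEquiv_eq_weakEquiv_syn {Sig Q S : Type} {ar : Sig → ℕ}
    [Fintype Q] [Semifield S]
    (μ : ∀ s : Sig, (Fin (ar s) → Q) → Q → S) (F : Finset Q)
    (hdet : Deterministic μ)
    (hlive : ∀ q : Q, Live μ F q)
    (sol : Q → Ctx Sig ar Q)
    (hsol : ∀ q : Q, SignOfLife μ F (sol q) q)
    (hsolF : ∀ q ∈ F, sol q = Ctx.hole)
    (hsolcl : ∀ q q' : Q, WeakEquiv μ F q q' → sol q = sol q')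
    (lam : Q → S) (hlam : ∀ q : Q, lam q = tweight μ ((sol q).subst (.state q))) :
    ∀ q q' : Q, MNEquiv μ F q q' ↔
      WeakEquiv (ar := fun p : Sig × S => ar p.1) (synMu (push lam μ)) F q q' := by
  have hlamcw : ∀ q, lam q = cweight μ F ((sol q).subst (.state q)) := fun q =>
    (hlam q).trans (hdet.tweight_eq_cweight (hsol q))
  have hlam0 : ∀ q, lam q ≠ 0 := fun q => hlamcw q ▸ (hdet.finReach_iff _ _).mp (hsol q)
  have hlamF : ∀ q ∈ F, lam q = 1 := fun q hq => by
    rw [hlam, hsolF q hq]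
    simp [tweight, Ctx.subst, hmu]
  have hscale : ∀ (s : S) (p p' : Q), s ≠ 0 → (∀ c : Ctx Sig ar Q,
      cweight μ F (c.subst (.state p)) = s * cweight μ F (c.subst (.state p'))) →
      lam p = s * lam p' := fun s p p' hs h => by
    rw [hlamcw, hlamcw, ← hsolcl p p' (MNEquiv.weakEquiv hdet ⟨s, hs, h⟩), h]
  have hdetP := hdet.push lam
  intro q q'
  constructor
  · intro h c
    rw [hdetP.synMu.finReach_iff, hdetP.synMu.finReach_iff,
      (isSimulation_mnEquiv_push hdet hlive hlam0 hscale).synMu.cweight_subst _ hdetP.synMu _ c h]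
    · rintro p p' ⟨s, hs, h⟩
      exact ⟨s⁻¹, inv_ne_zero hs, fun c => by rw [h c, inv_mul_cancel_left₀ hs]⟩
    · intro p p' h
      have := MNEquiv.weakEquiv hdet h .hole
      rwa [Ctx.subst, Ctx.subst, finReach_state, finReach_state] at this
  · intro h
    refine mnEquiv_of_cweight_push_eq hlam0 hlamF fun c => ?_
    refine (isSimulation_weakEquiv_synMu hdetP fun p =>
      ((hlive p).push hdet hlam0 hlamF).synMu hdetP).cweight_subst ?_ hdetP ?_ c h
    · exact fun p p' h c => (h c).symm
    · intro p p' h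
      have := h .hole
      rwa [Ctx.subst, Ctx.subst, finReach_state, finReach_state] at this

end WTA
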